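/- The subspace {x ∈ ⋀²V : φ(x∧w) = 0 for all φ ∈ K and all w ∈ W₄} of ⋀²V has dimension 5 over ℂ. (This is the intersection of the orthogonal complements of W₄ with respect to the polar forms of all quadrics vanishing on both P(W₄) and the Grassmannian of decomposable bivectors.) -/

import Mathlib

set_option synthInstance.maxHeartbeats 1000000
set_option maxHeartbeats 1000000

noncomputable section

open ExteriorAlgebra

/-- `V = ℂ⁶`. -/
abbrev V : Type := Fin 6 → ℂ

/-- The standard basis vectors `ε₀, …, ε₅` of `V`. -/
def ε (i : Fin 6) : V := Pi.single i 1

/-- The wedge `a ∧ b` of two vectors of `V`, as an element of the second exterior power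
`⋀[ℂ]^2 V` (a submodule of the exterior algebra of `V`). -/
def wedge2 (a b : V) : ⋀[ℂ]^2 V :=
  ⟨ι ℂ a * ι ℂ b, by
    have h := Submodule.mul_mem_mul (LinearMap.mem_range_self (ι ℂ (M := V)) a)
      (LinearMap.mem_range_self (ι ℂ (M := V)) b)
    simpa [pow_two] using h⟩

/-- The wedge of two bivectors, as an element of the fourth exterior power `⋀[ℂ]^4 V`. -/
def wedge4 (w w' : ⋀[ℂ]^2 V) : ⋀[ℂ]^4 V :=
  ⟨w.1 * w'.1, by
    have h := Submodule.mul_mem_mul w.2 w'.2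
    rwa [← pow_add] at h⟩

/-- The five decomposable bivectors `u₀ = ε₀∧ε₃`, `u₁ = ε₁∧ε₄`, `u₂ = ε₂∧ε₅`,
`u₃ = (ε₀+ε₁+ε₂)∧(ε₄+ε₃+ε₅)`, `u₄ = (ε₁+ε₄+ε₂)∧(ε₃+ε₁+ε₅)` of the paper's example. -/
def u : Fin 5 → ⋀[ℂ]^2 V :=
  ![wedge2 (ε 0) (ε 3), wedge2 (ε 1) (ε 4), wedge2 (ε 2) (ε 5),
    wedge2 (ε 0 + ε 1 + ε 2) (ε 4 + ε 3 + ε 5),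
    wedge2 (ε 1 + ε 4 + ε 2) (ε 3 + ε 1 + ε 5)]

/-- The linear functional `λ ↦ λ₀ + ⋯ + λ₄` on `ℂ⁵`. -/
def sumCoeff : (Fin 5 → ℂ) →ₗ[ℂ] ℂ := ∑ i, LinearMap.proj i

/-- The linear map `λ ↦ λ₀•u₀ + ⋯ + λ₄•u₄`. -/
def combo : (Fin 5 → ℂ) →ₗ[ℂ] ↥(⋀[ℂ]^2 V) := ∑ i, (LinearMap.proj i).smulRight (u i)

/-- `W₄ = {λ₀u₀ + ⋯ + λ₄u₄ : λᵢ ∈ ℂ, λ₀ + ⋯ + λ₄ = 0} ⊆ ⋀²V`. -/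
def W4 : Submodule ℂ ↥(⋀[ℂ]^2 V) := Submodule.map combo (LinearMap.ker sumCoeff)

/-- `K = {φ ∈ (⋀⁴V)* : φ(w∧w′) = 0 for all w, w′ ∈ W₄}`, a subspace of the dual space
of `⋀⁴V`. -/
def K : Submodule ℂ (Module.Dual ℂ ↥(⋀[ℂ]^4 V)) where
  carrier := {φ | ∀ w ∈ W4, ∀ w' ∈ W4, φ (wedge4 w w') = 0}
  zero_mem' := by intro w hw w' hw'; rfl
  add_mem' := by
    intro φ ψ hφ hψ w hw w' hw'
    simp [LinearMap.add_apply, hφ w hw w' hw', hψ w hw w' hw']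
  smul_mem' := by
    intro c φ hφ w hw w' hw'
    simp [LinearMap.smul_apply, hφ w hw w' hw']

/-- The subspace `{x ∈ ⋀²V : φ(x∧w) = 0 for all φ ∈ K and all w ∈ W₄}` of `⋀²V`:
the intersection of the orthogonal complements of `W₄` with respect to the polar forms of
all quadrics vanishing on both `P(W₄)` and the Grassmannian of decomposable bivectors. -/
def W5perp : Submodule ℂ ↥(⋀[ℂ]^2 V) where
  carrier := {x | ∀ φ ∈ K, ∀ w ∈ W4, φ (wedge4 x w) = 0}
  zero_mem' := by
    intro φ hφ w hw
    have h0 : wedge4 0 w = 0 := by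
      apply Subtype.ext; simp [wedge4]
    rw [h0, map_zero]
  add_mem' := by
    intro x y hx hy φ hφ w hw
    have h : wedge4 (x + y) w = wedge4 x w + wedge4 y w := by
      apply Subtype.ext; simp [wedge4, add_mul]
    rw [h, map_add, hx φ hφ w hw, hy φ hφ w hw, add_zero]
  smul_mem' := by
    intro c x hx φ hφ w hw
    have h : wedge4 (c • x) w = c • wedge4 x w := by
      apply Subtype.ext; simp [wedge4, smul_mul_assoc]
    rw [h, map_smul, hx φ hφ w hw, smul_zero]

/-- coordinate functional on bivectors -/
def F2 (i j : Fin 6) : ↥(⋀[ℂ]^2 V) →ₗ[ℂ] ℂ :=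
  exteriorPower.alternatingMapLinearEquiv
    ((Matrix.detRowAlternating (n := Fin 2) (R := ℂ)).compLinearMap (LinearMap.funLeft ℂ ℂ ![i, j]))

/-- coordinate functional on 4-vectors -/
def F4 (i j k l : Fin 6) : ↥(⋀[ℂ]^4 V) →ₗ[ℂ] ℂ :=
  exteriorPower.alternatingMapLinearEquiv
    ((Matrix.detRowAlternating (n := Fin 4) (R := ℂ)).compLinearMap
      (LinearMap.funLeft ℂ ℂ ![i, j, k, l]))

lemma wedge2_eq (a b : V) : wedge2 a b = exteriorPower.ιMulti ℂ 2 ![a, b] := by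
  apply Subtype.ext
  simp [wedge2, ExteriorAlgebra.ιMulti_apply]

lemma wedge4_eq (a b c d : V) :
    wedge4 (wedge2 a b) (wedge2 c d) = exteriorPower.ιMulti ℂ 4 ![a, b, c, d] := by
  apply Subtype.ext
  simp [wedge2, wedge4, ExteriorAlgebra.ιMulti_apply, mul_assoc]

lemma F2_apply (i j : Fin 6) (a b : V) : F2 i j (wedge2 a b) = a i * b j - a j * b i := by
  rw [wedge2_eq, F2, exteriorPower.alternatingMapLinearEquiv_apply_ιMulti]
  simp only [AlternatingMap.compLinearMap_apply]
  change Matrix.det (Matrix.of fun r s => (![a, b] r) (![i, j] s)) = _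
  rw [Matrix.det_fin_two]
  simp [LinearMap.funLeft]

lemma F4_apply (i j k l : Fin 6) (a b c d : V) :
    F4 i j k l (wedge4 (wedge2 a b) (wedge2 c d)) =
      (a i * b j - a j * b i) * (c k * d l - c l * d k)
      - (a i * b k - a k * b i) * (c j * d l - c l * d j)
      + (a i * b l - a l * b i) * (c j * d k - c k * d j)
      + (a j * b k - a k * b j) * (c i * d l - c l * d i)
      - (a j * b l - a l * b j) * (c i * d k - c k * d i)
      + (a k * b l - a l * b k) * (c i * d j - c j * d i) := by
  rw [wedge4_eq, F4, exteriorPower.alternatingMapLinearEquiv_apply_ιMulti]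
  simp only [AlternatingMap.compLinearMap_apply]
  change Matrix.det (Matrix.of fun r s => (![a, b, c, d] r) (![i, j, k, l] s)) = _
  rw [Matrix.det_succ_row_zero]
  simp [Fin.sum_univ_succ, Matrix.det_fin_three, LinearMap.funLeft, Fin.succAbove]
  ring

/-- wedge as a bilinear map -/
def wB : ↥(⋀[ℂ]^2 V) →ₗ[ℂ] ↥(⋀[ℂ]^2 V) →ₗ[ℂ] ↥(⋀[ℂ]^4 V) :=
  LinearMap.mk₂ ℂ wedge4
    (fun x y z => Subtype.ext (by simp [wedge4, add_mul]))
    (fun c x y => Subtype.ext (by simp [wedge4]))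
    (fun x y z => Subtype.ext (by simp [wedge4, mul_add]))
    (fun c x y => Subtype.ext (by simp [wedge4]))

lemma wB_apply (x y) : wB x y = wedge4 x y := rfl

lemma w2_comm (a b c d : V) :
    wedge4 (wedge2 a b) (wedge2 c d) = wedge4 (wedge2 c d) (wedge2 a b) := by
  apply Subtype.ext
  have h : ∀ x y : V, ι ℂ x * ι ℂ y = - (ι ℂ y * ι ℂ x) := fun x y =>
    eq_neg_of_add_eq_zero_left (ι_add_mul_swap x y)
  change ι ℂ a * ι ℂ b * (ι ℂ c * ι ℂ d) = ι ℂ c * ι ℂ d * (ι ℂ a * ι ℂ b)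
  calc ι ℂ a * ι ℂ b * (ι ℂ c * ι ℂ d) = ι ℂ a * (ι ℂ b * ι ℂ c) * ι ℂ d := by noncomm_ring
    _ = - ((ι ℂ a * ι ℂ c) * (ι ℂ b * ι ℂ d)) := by rw [h b c]; noncomm_ring
    _ = - (ι ℂ c * (ι ℂ a * ι ℂ d) * ι ℂ b) := by rw [h a c, h b d]; noncomm_ring
    _ = ι ℂ c * ι ℂ d * (ι ℂ a * ι ℂ b) := by rw [h a d]; noncomm_ring

lemma w2_self (a b : V) : wedge4 (wedge2 a b) (wedge2 a b) = 0 := by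
  apply Subtype.ext
  change ι ℂ a * ι ℂ b * (ι ℂ a * ι ℂ b) = 0
  have h : ι ℂ b * ι ℂ a = - (ι ℂ a * ι ℂ b) :=
    eq_neg_of_add_eq_zero_left (ι_add_mul_swap b a)
  calc ι ℂ a * ι ℂ b * (ι ℂ a * ι ℂ b) = ι ℂ a * (ι ℂ b * ι ℂ a) * ι ℂ b := by noncomm_ring
    _ = - ((ι ℂ a * ι ℂ a) * (ι ℂ b * ι ℂ b)) := by rw [h]; noncomm_ring
    _ = 0 := by simp

lemma u_dec (i : Fin 5) : ∃ a b, u i = wedge2 a b := by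
  fin_cases i <;> exact ⟨_, _, rfl⟩

lemma u_comm (i j : Fin 5) : wB (u i) (u j) = wB (u j) (u i) := by
  obtain ⟨a, b, h⟩ := u_dec i
  obtain ⟨c, d, h'⟩ := u_dec j
  rw [h, h']; exact w2_comm a b c d

lemma u_self (i : Fin 5) : wB (u i) (u i) = 0 := by
  obtain ⟨a, b, h⟩ := u_dec i
  rw [h]; exact w2_self a b

lemma combo_apply (c : Fin 5 → ℂ) : combo c = ∑ i, c i • u i := by
  simp [combo]

lemma diff_mem (i j : Fin 5) : u i - u j ∈ W4 := by
  refine ⟨Pi.single i 1 - Pi.single j 1, ?_, ?_⟩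
  · simp [sumCoeff]
  · rw [map_sub, combo_apply, combo_apply]
    simp [Pi.single_apply]

lemma mem_K_iff (φ : Module.Dual ℂ ↥(⋀[ℂ]^4 V)) :
    φ ∈ K ↔ ∀ i j, φ (wB (u i) (u j)) = 0 := by
  constructor
  · intro h
    have h4 : ∀ i j, φ (wB (u i) (u j)) = 0 := by
      intro i j
      have := h _ (diff_mem i j) _ (diff_mem i j)
      rw [← wB_apply] at this
      simp only [map_sub, LinearMap.sub_apply, u_self, u_comm j i] at this
      simp at this
      linear_combination (-1/2) * this
    exact h4
  · rintro h w ⟨c, -, rfl⟩ w' ⟨d, -, rfl⟩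
    rw [← wB_apply, combo_apply, combo_apply]
    simp [h]

lemma u_mem (i : Fin 5) : u i ∈ W5perp := by
  rintro φ hφ w ⟨c, -, rfl⟩
  rw [mem_K_iff] at hφ
  rw [← wB_apply, combo_apply]
  simp [hφ]

lemma u_indep : LinearIndependent ℂ u := by
  rw [Fintype.linearIndependent_iff]
  intro g hg
  have h := fun i j => congrArg (F2 i j) hg
  simp only [map_sum, map_smul, Fin.sum_univ_five, map_zero, u, smul_eq_mul] at h
  have h1 := h 4 5
  have h2 := h 0 4
  have h3 := h 0 3
  have h4 := h 1 4
  have h5 := h 2 5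
  simp [F2_apply, ε, Pi.single_apply] at h1 h2 h3 h4 h5
  simp_all
  intro i
  fin_cases i <;> simp_all

/-- Five functionals spanning `K`. -/
def ph : Fin 5 → Module.Dual ℂ ↥(⋀[ℂ]^4 V) :=
  ![F4 0 1 2 3 - F4 0 2 4 5 + F4 0 3 4 5 + F4 1 2 3 5 - F4 2 3 4 5,
    F4 0 1 2 4 - F4 0 2 4 5 + F4 1 2 3 5 - F4 2 3 4 5,
    F4 0 1 2 5 - F4 0 2 4 5 + F4 1 2 3 5 - F4 2 3 4 5,
    F4 0 1 3 5 - F4 0 2 3 4 - F4 0 2 4 5 + F4 0 3 4 5 + F4 1 2 3 5 - F4 2 3 4 5,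
    F4 1 3 4 5]

lemma ph_mem (k : Fin 5) : ph k ∈ K := by
  rw [mem_K_iff]
  intro i j
  fin_cases k <;> fin_cases i <;> fin_cases j <;>
    simp [ph, u, wB_apply, F4_apply, ε, Pi.single_apply]

/-- index of the functional used in each equation -/
def kI : Fin 10 → Fin 5 := ![4, 1, 1, 2, 2, 4, 0, 1, 3, 0]
/-- index of the vector of `W4` used in each equation -/
def lI : Fin 10 → Fin 5 := ![3, 2, 0, 2, 3, 1, 2, 1, 0, 0]

/-- Ten equations satisfied on `W5perp`. -/
def Φ : ↥(⋀[ℂ]^2 V) →ₗ[ℂ] (Fin 10 → ℂ) :=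
  LinearMap.pi fun m => (ph (kI m)).comp (wB.flip (u (lI m) - u 4))

lemma Φ_apply (x) (m : Fin 10) : Φ x m = ph (kI m) (wB x (u (lI m))) - ph (kI m) (wB x (u 4)) := by
  simp [Φ]

lemma Φ_w (a b : V) : Φ (wedge2 a b) = fun m => (
   let e : Fin 6 → Fin 6 → ℂ := fun i j => a i * b j - a j * b i
   (![- e 1 3 + e 1 5 - 2 * e 3 5,
     e 0 4 - e 1 5 + e 3 5 + e 4 5,
     e 1 3 - e 1 5 + e 3 4 + e 3 5 + e 4 5,
     2 * e 0 2 + e 0 5 - e 1 5 + e 3 5 + e 4 5,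
     e 0 2 + e 1 2 + e 2 3 - e 2 4 + 2 * e 3 5,
     - e 1 3 + e 1 5 - e 3 4 - 2 * e 3 5 - e 4 5,
     - e 0 1 + 2 * e 0 2 + e 0 5 - e 1 5 + e 3 5 + e 4 5,
     - e 0 2 + e 1 3 - e 1 5 + e 3 4 + e 3 5 + e 4 5,
     e 1 3 - 2 * e 1 5 + e 2 4 + e 3 4 + e 3 5 + 2 * e 4 5,
     - e 0 1 + 2 * e 0 2 - e 0 4 + e 0 5 + e 1 2 + e 1 3 - e 1 5 + e 3 4 + e 3 5 + 2 * e 4 5]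
      : Fin 10 → ℂ) m) := by
  funext m
  rw [Φ_apply]
  fin_cases m <;>
  · simp [ph, u, kI, lI, wB_apply, F4_apply, ε, Pi.single_apply]
    try ring

lemma W5perp_le : W5perp ≤ LinearMap.ker Φ := by
  intro x hx
  rw [LinearMap.mem_ker]
  funext m
  exact hx _ (ph_mem _) _ (diff_mem _ _)

lemma Φ_surj : Function.Surjective Φ := by
  intro y
  refine ⟨(y 3 - y 6) • wedge2 (ε 0) (ε 1) + (y 2 - y 7) • wedge2 (ε 0) (ε 2)
    + (y 1 + 2 * y 2 + y 5 - y 8) • wedge2 (ε 0) (ε 4)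
    + (y 3 + y 5 + 2 * y 7 - y 8) • wedge2 (ε 0) (ε 5)
    + (y 1 - y 2 - y 6 + y 9) • wedge2 (ε 1) (ε 2)
    + (- y 0 + 3 * y 2 + 2 * y 5 - y 8) • wedge2 (ε 1) (ε 3)
    + (y 2 - y 8) • wedge2 (ε 1) (ε 5)
    + (- y 1 + 2 * y 2 + y 4 + 2 * y 5 + y 6 + y 7 - y 9) • wedge2 (ε 2) (ε 3)
    + (y 0 - y 5) • wedge2 (ε 3) (ε 4)
    + (- y 2 - y 5) • wedge2 (ε 3) (ε 5), ?_⟩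
  simp only [map_add, map_smul, Φ_w]
  funext m
  fin_cases m <;>
  · simp [ε, Pi.single_apply]
    try ring

lemma finrank_two : Module.finrank ℂ ↥(⋀[ℂ]^2 V) = 15 := by
  rw [exteriorPower.finrank_eq]
  simp
  decide

/-- the subspace `{x ∈ ⋀²V : φ(x∧w) = 0 for all φ ∈ K and all w ∈ W₄}`
of `⋀²V` has dimension 5 over ℂ. -/
theorem W5perp_finrank_eq_five : Module.finrank ℂ ↥W5perp = 5 := by
  have hfin : Module.Finite ℂ ↥(⋀[ℂ]^2 V) :=
    Module.finite_of_finrank_pos (by rw [finrank_two]; norm_num)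
  apply le_antisymm
  · have h1 := Submodule.finrank_mono W5perp_le
    have h2 := LinearMap.finrank_range_add_finrank_ker Φ
    rw [LinearMap.range_eq_top.mpr Φ_surj, finrank_top, finrank_two] at h2
    simp at h2
    omega
  · have hli : LinearIndependent ℂ (fun i => (⟨u i, u_mem i⟩ : ↥W5perp)) :=
      LinearIndependent.of_comp W5perp.subtype u_indep
    simpa using hli.fintype_card_le_finrank
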